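/- arXiv:1804.10946 — 7 statements merged into one kernel-verified Lean document; each statement's English description precedes it below -/
import Mathlib

section
/- For every positive integer n there exists a constant J(n) such that for every field k of characteristic zero, every finite subgroup Γ of the general linear group GL_n(k) contains a normal abelian subgroup A with index [Γ : A] ≤ J(n). -/
open Module in
/-- A nonzero invariant subspace of an endomorphism contains an eigenvector. -/
theorem Module.End.exists_mem_hasEigenvector_of_mapsTo {K V : Type*} [Field K] [IsAlgClosed K]
    [AddCommGroup V] [Module K V] [FiniteDimensional K V] (f : End K V) {W : Submodule K V}
    (hW : W ≠ ⊥) (hf : ∀ x ∈ W, f x ∈ W) :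
    ∃ (c : K) (v : V), v ∈ W ∧ v ≠ 0 ∧ f v = c • v := by
  have : Nontrivial W := Submodule.nontrivial_iff_ne_bot.2 hW
  obtain ⟨c, hc⟩ := End.exists_eigenvalue (f.restrict hf)
  obtain ⟨v, hv⟩ := hc.exists_hasEigenvector
  refine ⟨c, v, v.2, fun h => hv.2 (Subtype.ext h), ?_⟩
  simpa using congrArg Subtype.val hv.apply_eq_smul

open Module in
/-- Two commuting endomorphisms have a common eigenvector in every nonzero subspace invariant
under both. -/
theorem Module.End.exists_mem_common_eigenvector {K V : Type*} [Field K] [IsAlgClosed K]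
    [AddCommGroup V] [Module K V] [FiniteDimensional K V] {f g : End K V} (hfg : Commute f g)
    {W : Submodule K V} (hW : W ≠ ⊥) (hf : ∀ x ∈ W, f x ∈ W) (hg : ∀ x ∈ W, g x ∈ W) :
    ∃ (c d : K) (v : V), v ∈ W ∧ v ≠ 0 ∧ f v = c • v ∧ g v = d • v := by
  obtain ⟨c, w, hwW, hw0, hw⟩ := f.exists_mem_hasEigenvector_of_mapsTo hW hf
  have hne : W ⊓ f.eigenspace c ≠ ⊥ := fun h =>
    hw0 ((Submodule.mem_bot K).1 (h ▸ ⟨hwW, End.mem_eigenspace_iff.2 hw⟩))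
  obtain ⟨d, v, hv, hv0, hgv⟩ := g.exists_mem_hasEigenvector_of_mapsTo hne fun x hx =>
    ⟨hg x hx.1, End.mem_eigenspace_iff.2 <| by
      rw [← End.mul_apply, hfg.eq, End.mul_apply, End.mem_eigenspace_iff.1 hx.2, map_smul]⟩
  exact ⟨c, d, v, hv.1, hv0, End.mem_eigenspace_iff.1 hv.2, hgv⟩

section Isometric

variable {E G : Type*} [NormedAddCommGroup E] [InnerProductSpace ℂ E] [Group G]
  {ρ : G →* (E →L[ℂ] E)}

/-- Eigenvectors of a norm-preserving map for distinct eigenvalues are orthogonal. -/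
theorem inner_eq_zero_of_norm_map_of_ne {T : E →L[ℂ] E} (hT : ∀ v, ‖T v‖ = ‖v‖) {c d : ℂ}
    (hcd : c ≠ d) {v w : E} (hv : T v = c • v) (hw : T w = d • w) : inner ℂ v w = 0 := by
  by_cases hv0 : v = 0
  · simp [hv0]
  have hinner := (LinearMap.norm_map_iff_inner_map_map T).1 hT
  have hc : ‖c‖ = 1 := by
    have := hT v
    rw [hv, norm_smul] at this
    exact (mul_eq_right₀ (norm_ne_zero_iff.2 hv0)).1 this
  have h := hinner v w
  rw [hv, hw, inner_smul_left, inner_smul_right, ← mul_assoc] at h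
  by_contra h0
  have h1 : (starRingEnd ℂ) c * d = 1 := (mul_eq_right₀ h0).1 h
  have h2 : c * (starRingEnd ℂ) c = 1 := by
    rw [Complex.mul_conj, Complex.normSq_eq_norm_sq, hc]; simp
  exact hcd (by linear_combination d * h2 - c * h1)

theorem norm_map_mul_le (hρ : ∀ g v, ‖ρ g v‖ = ‖v‖) (g : G) (T : E →L[ℂ] E) :
    ‖ρ g * T‖ ≤ ‖T‖ :=
  ContinuousLinearMap.opNorm_le_bound _ (norm_nonneg _) fun v => by
    simpa [hρ] using T.le_opNorm v

theorem norm_mul_map_le (hρ : ∀ g v, ‖ρ g v‖ = ‖v‖) (g : G) (T : E →L[ℂ] E) :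
    ‖T * ρ g‖ ≤ ‖T‖ :=
  ContinuousLinearMap.opNorm_le_bound _ (norm_nonneg _) fun v => by
    simpa [hρ] using T.le_opNorm (ρ g v)

theorem norm_map_conj_sub_one_le (hρ : ∀ g v, ‖ρ g v‖ = ‖v‖) (g h : G) :
    ‖ρ (g * h * g⁻¹) - 1‖ ≤ ‖ρ h - 1‖ := by
  have : ρ (g * h * g⁻¹) - 1 = ρ g * ((ρ h - 1) * ρ g⁻¹) := by
    rw [sub_mul, mul_sub, one_mul, ← map_mul, ← map_mul, ← map_mul, mul_inv_cancel, map_one,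
      mul_assoc]
  rw [this]
  exact (norm_map_mul_le hρ _ _).trans (norm_mul_map_le hρ _ _)

open scoped commutatorElement in
theorem norm_map_commutator_sub_one_le (hρ : ∀ g v, ‖ρ g v‖ = ‖v‖) (g h : G) :
    ‖ρ ⁅g, h⁆ - 1‖ ≤ 2 * ‖ρ g - 1‖ * ‖ρ h - 1‖ := by
  have : ρ ⁅g, h⁆ - 1 =
      ((ρ g - 1) * (ρ h - 1) - (ρ h - 1) * (ρ g - 1)) * ρ (h * g)⁻¹ := by
    have h1 : (ρ g - 1) * (ρ h - 1) - (ρ h - 1) * (ρ g - 1) = ρ (g * h) - ρ (h * g) := by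
      rw [map_mul, map_mul]; noncomm_ring
    rw [h1, sub_mul, ← map_mul, ← map_mul, mul_inv_cancel, map_one, commutatorElement_def,
      mul_inv_rev, ← mul_assoc]
  rw [this]
  refine (norm_mul_map_le hρ _ _).trans ((norm_sub_le _ _).trans ?_)
  linarith [norm_mul_le (ρ g - 1) (ρ h - 1), norm_mul_le (ρ h - 1) (ρ g - 1)]

variable [FiniteDimensional ℂ E]

/-- An isometry at distance less than one from the identity which conjugates another isometry of
finite order into something commuting with it commutes with that isometry. -/
theorem commute_of_commute_conj [Finite G] (hinj : Function.Injective ρ)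
    (hρ : ∀ g v, ‖ρ g v‖ = ‖v‖) {g h : G} (hh : ‖ρ h - 1‖ < 1)
    (hcomm : Commute g (h⁻¹ * g * h)) : Commute g h := by
  set u : G := h⁻¹ * g * h * g⁻¹ with hu
  have hgu : Commute g u := hcomm.mul_right (Commute.refl g).inv_right
  suffices u = 1 by
    rw [hu, mul_inv_eq_one, mul_assoc, inv_mul_eq_iff_eq_mul] at this
    exact this
  by_contra hu1
  let U : Module.End ℂ E := (ρ u : E →L[ℂ] E)
  let A : Module.End ℂ E := (ρ g : E →L[ℂ] E)
  have hUA : Commute U A := by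
    have : ρ u * ρ g = ρ g * ρ u := by rw [← map_mul, ← map_mul, hgu.eq]
    exact LinearMap.ext fun v => congrArg (fun T : E →L[ℂ] E => T v) this
  let R := LinearMap.range (U - 1)
  have hR : R ≠ ⊥ := fun hbot => hu1 <| hinj <| by
    rw [LinearMap.range_eq_bot, sub_eq_zero] at hbot
    rw [map_one]
    ext v
    exact LinearMap.congr_fun hbot v
  have hstable (T : Module.End ℂ E) (hT : Commute T U) : ∀ x ∈ R, T x ∈ R := by
    rintro _ ⟨w, rfl⟩
    refine ⟨T w, ?_⟩
    have := (hT.sub_right (Commute.one_right T)).eq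
    exact (LinearMap.congr_fun this w).symm
  obtain ⟨c, d, v, hvR, hv0, hUv, hAv⟩ := Module.End.exists_mem_common_eigenvector hUA hR
    (hstable U (Commute.refl U)) (hstable A hUA.symm)
  have hUv' : ρ u v = c • v := hUv
  have hAv' : ρ g v = d • v := hAv
  have hconj : ρ g (ρ h v) = (d * c) • ρ h v := by
    have : g * h = h * (u * g) := by rw [hu]; group
    have := congrArg (fun T : E →L[ℂ] E => T v) (congrArg ρ this)
    simpa [hUv', hAv', smul_smul] using this
  have hc : c = 1 := by
    by_contra hc
    have hd : d ≠ 0 := by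
      rintro rfl
      have := hρ g v
      rw [hAv', zero_smul, norm_zero] at this
      exact hv0 (norm_eq_zero.1 this.symm)
    have horth : inner ℂ v (ρ h v) = 0 :=
      inner_eq_zero_of_norm_map_of_ne (hρ g) (fun h => hc ((mul_eq_left₀ hd).1 h.symm)) hAv' hconj
    have hlt : ‖ρ h v - v‖ < ‖v‖ := by
      have h1 := (ρ h - 1).le_opNorm v
      have h2 := mul_lt_mul_of_pos_right hh (norm_pos_iff.2 hv0)
      simp only [sub_apply, one_apply_eq_self] at h1
      linarith
    have := norm_sub_sq (𝕜 := ℂ) v (ρ h v)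
    rw [horth, hρ, norm_sub_rev] at this
    simp at this
    nlinarith [norm_nonneg (ρ h v - v), norm_nonneg v]
  rw [hc, one_smul] at hUv
  obtain ⟨w, rfl⟩ := hvR
  have hpow (i : ℕ) (x : E) (hx : U x = x) : (U ^ i) x = x := by
    induction i with
    | zero => rfl
    | succ i ih => rw [pow_succ, Module.End.mul_apply, hx, ih]
  have hord : U ^ orderOf u = 1 := by
    have : ρ u ^ orderOf u = 1 := by rw [← map_pow, pow_orderOf_eq_one, map_one]
    have := congrArg (fun T : E →L[ℂ] E => (T : Module.End ℂ E)) this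
    simpa using this
  have hgeom : (∑ i ∈ Finset.range (orderOf u), U ^ i) * (U - 1) = 0 := by
    rw [geom_sum_mul, hord, sub_self]
  have := LinearMap.congr_fun hgeom w
  rw [Module.End.mul_apply, LinearMap.sum_apply, Finset.sum_congr rfl
    fun i _ => hpow i _ hUv] at this
  simp only [Finset.sum_const, Finset.card_range, LinearMap.zero_apply] at this
  rw [← Nat.cast_smul_eq_nsmul ℂ, smul_eq_zero] at this
  exact this.elim (fun h => (orderOf_pos u).ne' (by exact_mod_cast h)) hv0

open scoped commutatorElement in
/-- Elements of a finite isometry group close to the identity commute. -/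
theorem commute_of_norm_map_sub_one_lt [Finite G] (hinj : Function.Injective ρ)
    (hρ : ∀ g v, ‖ρ g v‖ = ‖v‖) {g h : G} (hg : ‖ρ g - 1‖ < 1 / 2) (hh : ‖ρ h - 1‖ < 1 / 2) :
    Commute g h := by
  by_contra hgh
  let S : Set G := {x | ‖ρ x - 1‖ < 1 / 2 ∧ ¬ Commute g x}
  obtain ⟨x, ⟨hx, hgx⟩, hmin⟩ := S.toFinite.exists_minimalFor (fun x => ‖ρ x - 1‖) S ⟨h, hh, hgh⟩
  have hx0 : 0 < ‖ρ x - 1‖ := by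
    refine norm_pos_iff.2 fun h0 => hgx ?_
    rw [sub_eq_zero, ← map_one ρ] at h0
    rw [hinj h0]
    exact Commute.one_right g
  have hlt : ‖ρ ⁅g, x⁆ - 1‖ < ‖ρ x - 1‖ := by
    refine (norm_map_commutator_sub_one_le hρ g x).trans_lt ?_
    nlinarith
  have hcomm : Commute g ⁅g, x⁆ := by
    by_contra hnot
    exact hlt.not_ge (hmin (j := ⁅g, x⁆) ⟨hlt.trans hx, hnot⟩ hlt.le)
  have h1 : Commute g (x * g * x⁻¹) := by
    have h2 : x * g * x⁻¹ = (g⁻¹ * ⁅g, x⁆)⁻¹ := by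
      rw [commutatorElement_def]; group
    rw [h2]
    exact ((Commute.refl g).inv_right.mul_right hcomm).inv_right
  have h3 : ‖ρ x⁻¹ - 1‖ < 1 := by
    have h4 : ρ x⁻¹ - 1 = ρ x⁻¹ * (1 - ρ x) := by
      rw [mul_sub, mul_one, ← map_mul, inv_mul_cancel, map_one]
    rw [h4]
    refine (norm_map_mul_le hρ _ _).trans_lt ?_
    rw [norm_sub_rev]
    linarith
  have h5 : Commute g x⁻¹ := commute_of_commute_conj hinj hρ h3 (by rwa [inv_inv])
  exact hgx (by simpa using h5.inv_right)

end Isometric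

/-- Jordan's theorem for finite groups of isometries of a finite-dimensional inner product
space. -/
theorem exists_forall_normal_commutative_index_le_of_isometric (E : Type*) [NormedAddCommGroup E]
    [InnerProductSpace ℂ E] [FiniteDimensional ℂ E] :
    ∃ J : ℕ, ∀ (G : Type) [Group G] [Finite G] (ρ : G →* (E →L[ℂ] E)),
      Function.Injective ρ → (∀ g v, ‖ρ g v‖ = ‖v‖) →
        ∃ A : Subgroup G, A.Normal ∧ (∀ x y : A, x * y = y * x) ∧ A.index ≤ J := by
  have : ProperSpace (E →L[ℂ] E) := FiniteDimensional.proper ℂ _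
  obtain ⟨t, ht, hcover⟩ := Metric.totallyBounded_iff.1
    (isCompact_closedBall (0 : E →L[ℂ] E) 1).totallyBounded (1 / 4) (by norm_num)
  refine ⟨t.ncard, fun G _ _ ρ hinj hρ => ?_⟩
  let S : Set G := {g | ‖ρ g - 1‖ < 1 / 2}
  refine ⟨Subgroup.closure S, ?_, ?_, ?_⟩
  · have hnorm : Subgroup.normalizer S = ⊤ := by
      refine (Subgroup.eq_top_iff' _).2 fun g => Subgroup.mem_set_normalizer_iff.2 fun h => ?_
      refine ⟨(norm_map_conj_sub_one_le hρ g h).trans_lt, fun hgh => ?_⟩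
      have := (norm_map_conj_sub_one_le hρ g⁻¹ (g * h * g⁻¹)).trans_lt hgh
      simpa [S, mul_assoc] using this
    exact Subgroup.normalizer_eq_top_iff.1
      (top_le_iff.1 (hnorm ▸ Subgroup.normalizer_le_normalizer_closure S))
  · have := Subgroup.isMulCommutative_closure (k := S) fun a ha b hb =>
      (commute_of_norm_map_sub_one_lt hinj hρ ha hb).eq
    exact fun x y => mul_comm' x y
  · have hball (g : G) : ∃ c : t, ρ g ∈ Metric.ball (c : E →L[ℂ] E) (1 / 4) := by
      have : ρ g ∈ Metric.closedBall (0 : E →L[ℂ] E) 1 := by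
        rw [mem_closedBall_zero_iff]
        exact ContinuousLinearMap.opNorm_le_bound _ zero_le_one fun v => by rw [hρ, one_mul]
      simpa only [Set.mem_iUnion, Subtype.exists, exists_prop] using hcover this
    choose c hc using hball
    have := ht.to_subtype
    rw [Subgroup.index, ← Nat.card_coe_set_eq]
    refine Nat.card_le_card_of_injective
      (fun q : G ⧸ Subgroup.closure S => c q.out) fun p q hpq => ?_
    rw [← p.out_eq', ← q.out_eq']
    refine QuotientGroup.eq.2 (Subgroup.subset_closure ?_)
    have h1 := hc p.out
    have h2 := hc q.out
    rw [show c p.out = c q.out from hpq] at h1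
    have h3 : ρ (p.out⁻¹ * q.out) - 1 = ρ p.out⁻¹ * (ρ q.out - ρ p.out) := by
      rw [mul_sub, ← map_mul, ← map_mul, inv_mul_cancel, map_one]
    change ‖ρ (p.out⁻¹ * q.out) - 1‖ < 1 / 2
    rw [h3]
    refine (norm_map_mul_le hρ _ _).trans_lt ?_
    rw [← dist_eq_norm]
    have := dist_triangle_right (ρ q.out) (ρ p.out) (c q.out : E →L[ℂ] E)
    rw [Metric.mem_ball] at h1 h2
    linarith

open scoped ComplexOrder MatrixOrder Matrix.Norms.L2Operator Matrix in
/-- Weyl's unitary trick: a finite group of complex matrices is conjugate to a group of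
isometries. -/
theorem exists_isometric_of_finite {G : Type*} [Group G] [Finite G] {n : ℕ}
    (σ : G →* Matrix (Fin n) (Fin n) ℂ) (hσ : Function.Injective σ) :
    ∃ ρ : G →* (EuclideanSpace ℂ (Fin n) →L[ℂ] EuclideanSpace ℂ (Fin n)),
      Function.Injective ρ ∧ ∀ g v, ‖ρ g v‖ = ‖v‖ := by
  have := Fintype.ofFinite G
  let P : Matrix (Fin n) (Fin n) ℂ := ∑ g, (σ g)ᴴ * σ g
  have hP : P.PosDef := Matrix.posDef_sum Finset.univ_nonempty fun g _ =>
    Matrix.PosDef.conjTranspose_mul_self _ <|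
      Matrix.mulVec_injective_of_isUnit ((Group.isUnit g).map σ)
  have hinv (h : G) : (σ h)ᴴ * P * σ h = P := by
    simp only [P, Finset.mul_sum, Finset.sum_mul]
    refine Fintype.sum_equiv (Equiv.mulRight h) _ _ fun g => ?_
    simp [Matrix.mul_assoc, Matrix.conjTranspose_mul]
  obtain ⟨S, hS, hPS⟩ : ∃ S : Matrix (Fin n) (Fin n) ℂ, IsUnit S ∧ P = Sᴴ * S :=
    CStarAlgebra.isStrictlyPositive_iff_eq_star_mul_self.1 hP.isStrictlyPositive
  obtain ⟨s, rfl⟩ := hS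
  let τ : G →* Matrix (Fin n) (Fin n) ℂ :=
    { toFun g := (s : Matrix (Fin n) (Fin n) ℂ) * σ g * (↑s⁻¹ : Matrix (Fin n) (Fin n) ℂ)
      map_one' := by simp
      map_mul' g h := by simp [mul_assoc] }
  have hτ (g : G) : (τ g)ᴴ * τ g = 1 := by
    have h1 : (τ g)ᴴ * τ g = (↑s⁻¹ : Matrix (Fin n) (Fin n) ℂ)ᴴ *
        ((σ g)ᴴ * ((s : Matrix (Fin n) (Fin n) ℂ)ᴴ * s) * σ g) *
          (↑s⁻¹ : Matrix (Fin n) (Fin n) ℂ) := by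
      simp [τ, Matrix.conjTranspose_mul, Matrix.mul_assoc]
    rw [h1, ← hPS, hinv, hPS, ← Matrix.mul_assoc, ← Matrix.conjTranspose_mul]
    simp
  refine ⟨(Matrix.toEuclideanCLM (n := Fin n) (𝕜 := ℂ) :
    Matrix (Fin n) (Fin n) ℂ →* _).comp τ, ?_, fun g => ?_⟩
  · refine (EquivLike.injective (Matrix.toEuclideanCLM (n := Fin n) (𝕜 := ℂ))).comp fun g h hgh =>
      hσ ?_
    exact (Units.mul_right_inj s).1 ((Units.mul_left_inj s⁻¹).1 hgh)
  · rw [ContinuousLinearMap.norm_map_iff_adjoint_comp_self]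
    have := congrArg (Matrix.toEuclideanCLM (n := Fin n) (𝕜 := ℂ)) (hτ g)
    rw [map_mul, map_one, ← Matrix.star_eq_conjTranspose, map_star] at this
    exact this

open Cardinal in
/-- A countable field of characteristic zero embeds into the complex numbers. -/
theorem nonempty_ringHom_complex_of_countable (K : Type) [Field K] [CharZero K] [Countable K] :
    Nonempty (K →+* ℂ) := by
  let F := FractionRing (MvPolynomial ℝ K)
  have hF : #F = 𝔠 := by
    rw [FractionRing.cardinalMk, MvPolynomial.cardinalMk_eq_max, mk_real,
      max_eq_right ((mk_le_aleph0 (α := K)).trans aleph0_le_continuum),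
      max_eq_left aleph0_le_continuum]
  have hL : #(AlgebraicClosure F) = 𝔠 := by
    refine le_antisymm ?_ ?_
    · refine (Algebra.IsAlgebraic.cardinalMk_le_max F _).trans ?_
      rw [hF, max_eq_left aleph0_le_continuum]
    · rw [← hF]
      exact mk_le_of_injective (algebraMap F (AlgebraicClosure F)).injective
  have : CharZero F := charZero_of_injective_algebraMap
    (FaithfulSMul.algebraMap_injective K F)
  have : CharZero (AlgebraicClosure F) := charZero_of_injective_algebraMap
    (algebraMap F (AlgebraicClosure F)).injective
  obtain ⟨e⟩ := IsAlgClosed.ringEquiv_of_equiv_of_charZero (K := AlgebraicClosure F) (L := ℂ)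
    (by rw [hL]; exact aleph0_lt_continuum) (Cardinal.eq.1 (by rw [hL, mk_complex]))
  exact ⟨e.toRingHom.comp ((algebraMap F (AlgebraicClosure F)).comp (algebraMap K F))⟩

/-- A finite group of matrices over a field of characteristic zero is isomorphic to a group of
complex matrices of the same size. -/
theorem exists_injective_complex_matrix {k : Type} [Field k] [CharZero k] {G : Type*} [Group G]
    [Finite G] {n : ℕ} (σ : G →* Matrix (Fin n) (Fin n) k) (hσ : Function.Injective σ) :
    ∃ τ : G →* Matrix (Fin n) (Fin n) ℂ, Function.Injective τ := by
  let s : Set k := Set.range fun x : G × Fin n × Fin n => σ x.1 x.2.1 x.2.2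
  let K := IntermediateField.adjoin ℚ s
  have hs : s.Countable := (Set.finite_range _).countable
  have : Countable K := by
    rw [← Cardinal.mk_le_aleph0_iff]
    refine (IntermediateField.cardinalMk_adjoin_le ℚ s).trans ?_
    simp
  obtain ⟨f⟩ := nonempty_ringHom_complex_of_countable K
  have hval : Function.Injective (K.val.toRingHom.mapMatrix (m := Fin n)) :=
    Matrix.map_injective K.val.injective
  choose σ' hσ' using fun g : G => show ∃ M : Matrix (Fin n) (Fin n) K,
      K.val.toRingHom.mapMatrix M = σ g from
    ⟨Matrix.of fun i j => ⟨σ g i j, IntermediateField.subset_adjoin ℚ s ⟨(g, i, j), rfl⟩⟩, rfl⟩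
  let σK : G →* Matrix (Fin n) (Fin n) K :=
    { toFun := σ'
      map_one' := hval (by rw [hσ', map_one, map_one])
      map_mul' g h := hval (by rw [hσ', map_mul, map_mul, hσ', hσ']) }
  refine ⟨(f.mapMatrix : Matrix (Fin n) (Fin n) K →+* Matrix (Fin n) (Fin n) ℂ).toMonoidHom.comp σK, ?_⟩
  refine (Matrix.map_injective f.injective).comp fun g h hgh => hσ ?_
  rw [← hσ', ← hσ']
  exact congrArg _ hgh

/-- Jordan's theorem: for every positive integer `n` there is a constant `J`
(depending only on `n`) such that for every field `k` of characteristic zero,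
every finite subgroup `Γ` of `GL_n(k)` contains a normal abelian subgroup `A`
of index at most `J`. -/
theorem stmt_0 (n : ℕ) (hn : 0 < n) :
    ∃ J : ℕ, ∀ (k : Type) [Field k] [CharZero k],
      ∀ Γ : Subgroup (Matrix.GeneralLinearGroup (Fin n) k), Finite Γ →
        ∃ A : Subgroup Γ, A.Normal ∧ (∀ x y : A, x * y = y * x) ∧ A.index ≤ J := by
  obtain ⟨J, hJ⟩ :=
    exists_forall_normal_commutative_index_le_of_isometric (EuclideanSpace ℂ (Fin n))
  refine ⟨J, fun k _ _ Γ _ => ?_⟩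
  obtain ⟨τ, hτ⟩ := exists_injective_complex_matrix
    ((Units.coeHom (Matrix (Fin n) (Fin n) k)).comp Γ.subtype)
    (Units.val_injective.comp Γ.subtype_injective)
  obtain ⟨ρ, hinj, hρ⟩ := exists_isometric_of_finite τ hτ
  exact hJ Γ ρ hinj hρ
end

section
/- Let p be a prime number or zero, let G be a group, and let K be a finite normal subgroup of G whose order is not divisible by p. Suppose there is a constant J such that every finite subgroup of G whose order is not divisible by p contains a normal abelian subgroup of index ≤ J. Then every finite subgroup Γ of the quotient group G/K whose order is not divisible by p contains a normal abelian subgroup A with [Γ : A] ≤ J. -/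
/-- If `G` is generalized `p`-Jordan with constant `J` (with `p` a prime or
zero) and `K` is a finite normal subgroup of `G` of order not divisible by `p`,
then `G/K` is generalized `p`-Jordan with constant `J`. -/
theorem stmt_5 (p : ℕ) (hp : p = 0 ∨ p.Prime) (G : Type*) [Group G]
    (K : Subgroup G) [K.Normal] (hKfin : Finite K) (hKp : ¬ p ∣ Nat.card K)
    (J : ℕ)
    (hG : ∀ Γ : Subgroup G, Finite Γ → ¬ p ∣ Nat.card Γ →
      ∃ A : Subgroup Γ, A.Normal ∧ (∀ x y : A, x * y = y * x) ∧ A.index ≤ J) :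
    ∀ Γ : Subgroup (G ⧸ K), Finite Γ → ¬ p ∣ Nat.card Γ →
      ∃ A : Subgroup Γ, A.Normal ∧ (∀ x y : A, x * y = y * x) ∧ A.index ≤ J := by
  intro Γ hΓfin hΓp
  let Δ : Subgroup G := Γ.comap (QuotientGroup.mk' K)
  have hcard : Nat.card Δ = Nat.card K * Nat.card Γ :=
    QuotientGroup.card_preimage_mk K (Γ : Set (G ⧸ K))
  have hΔfin : Finite Δ := Nat.finite_of_card_ne_zero <| by
    rw [hcard]
    exact mul_ne_zero Nat.card_pos.ne' Nat.card_pos.ne'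
  have hΔp : ¬ p ∣ Nat.card Δ := by
    rcases hp with rfl | hp
    · exact fun h => Nat.card_pos.ne' (zero_dvd_iff.mp h)
    · rw [hcard, hp.dvd_mul]
      exact not_or.mpr ⟨hKp, hΓp⟩
  obtain ⟨A, hAnormal, hAcomm, hAindex⟩ := hG Δ hΔfin hΔp
  let f : Δ →* Γ := (QuotientGroup.mk' K).subgroupComap Γ
  have hf : Function.Surjective f :=
    (QuotientGroup.mk' K).subgroupComap_surjective_of_surjective Γ
      (QuotientGroup.mk'_surjective K)
  refine ⟨A.map f, hAnormal.map f hf, ?_, ?_⟩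
  · rintro ⟨_, a, ha, rfl⟩ ⟨_, b, hb, rfl⟩
    have hab : a * b = b * a := congrArg Subtype.val (hAcomm ⟨a, ha⟩ ⟨b, hb⟩)
    refine Subtype.ext ?_
    change f a * f b = f b * f a
    rw [← map_mul, hab, map_mul]
  · exact (Nat.le_of_dvd (Nat.pos_of_ne_zero Subgroup.index_ne_zero_of_finite)
      (A.index_map_dvd hf)).trans hAindex
end

section
/- Let p be a prime number, let G be a group, and let K be a finite normal subgroup of G whose Sylow p-subgroup K_(p) is normal in K. Suppose there is a constant J such that every finite subgroup of G whose order is not divisible by p contains a normal abelian subgroup of index ≤ J. Then every finite subgroup Γ of the quotient group G/K whose order is not divisible by p contains a normal abelian subgroup A with [Γ : A] ≤ J. -/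
/-- A finite subgroup of `G ⧸ K` of order prime to `p` is the image of one of `G` when the finite normal
subgroup `K` has a normal Sylow `p`-subgroup. -/
theorem Subgroup.exists_map_mk_eq_of_sylow_normal {p : ℕ} [Fact p.Prime] {G : Type*} [Group G]
    {K : Subgroup G} [K.Normal] [Finite K] (P : Sylow p K) (hP : P.toSubgroup.Normal)
    (Γ : Subgroup (G ⧸ K)) [Finite Γ] (hΓ : ¬ p ∣ Nat.card Γ) :
    ∃ C : Subgroup G, Finite C ∧ ¬ p ∣ Nat.card C ∧ C.map (QuotientGroup.mk' K) = Γ := by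
  set f := QuotientGroup.mk' K
  have hf : Function.Surjective f := QuotientGroup.mk'_surjective K
  set H := Γ.comap f
  have hKH : K ≤ H := by
    simpa [f, H] using f.ker_le_comap Γ
  have hrelK : K.relIndex H = Nat.card Γ := by
    have h := Subgroup.relIndex_comap ⊥ f H
    rwa [MonoidHom.comap_bot, QuotientGroup.ker_mk', Subgroup.map_comap_eq_self_of_surjective hf,
      Subgroup.relIndex_bot_left] at h
  have hchar : P.toSubgroup.Characteristic := P.characteristic_of_normal hP
  set P' := P.toSubgroup.map K.subtype
  have hP'K : P' ≤ K := Subgroup.map_subtype_le _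
  have hP'n : P'.Normal := inferInstance
  have hrelP : P'.relIndex K = P.toSubgroup.index := by
    rw [Subgroup.relIndex, Subgroup.subgroupOf,
      Subgroup.comap_map_eq_self_of_injective K.subtype_injective]
  have hrel : P'.relIndex H = P.toSubgroup.index * Nat.card Γ := by
    rw [← hrelP, ← hrelK, Subgroup.relIndex_mul_relIndex _ _ _ hP'K hKH]
  have hindex : ¬ p ∣ (P'.subgroupOf H).index := by
    change ¬ p ∣ P'.relIndex H
    rw [hrel, (Fact.out : p.Prime).dvd_mul]
    exact not_or.2 ⟨P.not_dvd_index, hΓ⟩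
  have hpgroup : IsPGroup p (P'.subgroupOf H) :=
    (P.isPGroup'.map K.subtype).comap_of_injective H.subtype H.subtype_injective
  have hfinP : Finite P' := Finite.of_injective _ (Subgroup.inclusion_injective hP'K)
  have hfinN : Finite (P'.subgroupOf H) :=
    Finite.of_injective _ (Subgroup.subgroupOfEquivOfLe (hP'K.trans hKH)).injective
  obtain ⟨k, hk⟩ := IsPGroup.iff_card.1 hpgroup
  have hcop : (Nat.card (P'.subgroupOf H)).Coprime (P'.subgroupOf H).index := by
    rw [hk]
    exact Nat.Coprime.pow_left _ (((Fact.out : p.Prime).coprime_iff_not_dvd).2 hindex)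
  obtain ⟨Q, hQ⟩ := Subgroup.exists_right_complement'_of_coprime hcop
  have hcard : Nat.card (Q.map H.subtype) = (P'.subgroupOf H).index := by
    rw [Subgroup.card_map_of_injective H.subtype_injective, hQ.symm.index_eq_card]
  refine ⟨Q.map H.subtype, ?_, by rwa [hcard], le_antisymm ?_ ?_⟩
  · refine Nat.finite_of_card_ne_zero fun h => hindex ?_
    rw [← hcard, h]
    exact dvd_zero p
  · exact Subgroup.map_le_iff_le_comap.2 (Subgroup.map_subtype_le _)
  · intro γ hγ
    obtain ⟨g, rfl⟩ := hf γ
    obtain ⟨⟨n, q⟩, hnq⟩ := hQ.2 ⟨g, hγ⟩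
    refine ⟨q.1.1, ⟨q.1, q.2, rfl⟩, ?_⟩
    have hg : n.1.1 * q.1.1 = g := congrArg Subtype.val hnq
    have hn : f n.1.1 = 1 := (QuotientGroup.eq_one_iff _).2 (hP'K n.2)
    rw [← hg, map_mul, hn, one_mul]


/-- If `G` is generalized `p`-Jordan with constant `J` (with `p` prime) and `K`
is a finite normal subgroup of `G` having a normal Sylow `p`-subgroup, then
`G/K` is generalized `p`-Jordan with constant `J`. -/
theorem stmt_6 (p : ℕ) (hp : p.Prime) (G : Type*) [Group G]
    (K : Subgroup G) [K.Normal] (hKfin : Finite K)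
    (hKp : ∃ P : Sylow p ↥K, P.toSubgroup.Normal)
    (J : ℕ)
    (hG : ∀ Γ : Subgroup G, Finite Γ → ¬ p ∣ Nat.card Γ →
      ∃ A : Subgroup Γ, A.Normal ∧ (∀ x y : A, x * y = y * x) ∧ A.index ≤ J) :
    ∀ Γ : Subgroup (G ⧸ K), Finite Γ → ¬ p ∣ Nat.card Γ →
      ∃ A : Subgroup Γ, A.Normal ∧ (∀ x y : A, x * y = y * x) ∧ A.index ≤ J := by
  intro Γ hΓfin hΓ
  have : Fact p.Prime := ⟨hp⟩
  obtain ⟨P, hP⟩ := hKp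
  obtain ⟨C, hCfin, hC, rfl⟩ := Subgroup.exists_map_mk_eq_of_sylow_normal P hP Γ hΓ
  obtain ⟨A, hAn, hAcomm, hAJ⟩ := hG C hCfin hC
  have hsurj := (QuotientGroup.mk' K).subgroupMap_surjective C
  refine ⟨A.map ((QuotientGroup.mk' K).subgroupMap C), hAn.map _ hsurj, ?_, ?_⟩
  · rintro ⟨_, a, ha, rfl⟩ ⟨_, b, hb, rfl⟩
    have hab : a * b = b * a := congrArg Subtype.val (hAcomm ⟨a, ha⟩ ⟨b, hb⟩)
    refine Subtype.ext ?_
    simp only [Subgroup.coe_mul, ← map_mul, hab]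
  · exact (Nat.le_of_dvd (Nat.pos_of_ne_zero Subgroup.index_ne_zero_of_finite)
      (A.index_map_dvd hsurj)).trans hAJ
end

section
/- Let p be a prime number, let G be a group, and let K be a finite normal subgroup of G. Suppose there are constants J' and e such that every finite subgroup Δ of G contains a normal abelian subgroup of order not divisible by p and of index ≤ J' · |Δ_(p)|^{e}, where Δ_(p) is a Sylow p-subgroup of Δ. Then every finite subgroup Γ of G/K contains a normal abelian subgroup A of order not divisible by p with [Γ : A] ≤ J' · |K_(p)|^{e} · |Γ_(p)|^{e}, where K_(p) and Γ_(p) are Sylow p-subgroups of K and Γ respectively. -/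
/-- The preimage of `Γ ≤ G ⧸ K` in `G` has cardinality `|Γ| * |K|`. -/
theorem Subgroup.card_comap_mk' {G : Type*} [Group G] (K : Subgroup G) [K.Normal]
    (Γ : Subgroup (G ⧸ K)) :
    Nat.card (Γ.comap (QuotientGroup.mk' K)) = Nat.card Γ * Nat.card K := by
  have hle : K ≤ Γ.comap (QuotientGroup.mk' K) := QuotientGroup.le_comap_mk' K Γ
  have hf := MonoidHom.subgroupComap_surjective_of_surjective (QuotientGroup.mk' K) Γ
    (QuotientGroup.mk'_surjective K)
  have hker : ((QuotientGroup.mk' K).subgroupComap Γ).ker =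
      K.subgroupOf (Γ.comap (QuotientGroup.mk' K)) := by
    ext x
    rw [MonoidHom.mem_ker, Subgroup.mem_subgroupOf, ← QuotientGroup.eq_one_iff, Subtype.ext_iff]
    rfl
  rw [Subgroup.card_eq_card_quotient_mul_card_subgroup
      ((QuotientGroup.mk' K).subgroupComap Γ).ker,
    Nat.card_congr (QuotientGroup.quotientKerEquivOfSurjective _ hf).toEquiv, hker,
    Nat.card_congr (Subgroup.subgroupOfEquivOfLe hle).toEquiv]


/-- If `G` is `p`-Jordan with constants `(J', e)` and `K` is a finite normal
subgroup of `G`, then `G/K` is `p`-Jordan with constants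
`(J' * |K_(p)|^e, e)`. -/
theorem stmt_7 (p : ℕ) (hp : p.Prime) (G : Type*) [Group G]
    (K : Subgroup G) [K.Normal] (hKfin : Finite K) (J' e : ℕ)
    (hG : ∀ Δ : Subgroup G, Finite Δ →
      ∃ A : Subgroup Δ, A.Normal ∧ (∀ x y : A, x * y = y * x) ∧
        ¬ p ∣ Nat.card A ∧
        ∀ P : Sylow p Δ, A.index ≤ J' * Nat.card P.toSubgroup ^ e) :
    ∀ Γ : Subgroup (G ⧸ K), Finite Γ →
      ∃ A : Subgroup Γ, A.Normal ∧ (∀ x y : A, x * y = y * x) ∧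
        ¬ p ∣ Nat.card A ∧
        ∀ (P : Sylow p ↥K) (Q : Sylow p Γ),
          A.index ≤ J' * Nat.card P.toSubgroup ^ e * Nat.card Q.toSubgroup ^ e := by
  have : Fact p.Prime := ⟨hp⟩
  intro Γ hΓ
  have hcard := Subgroup.card_comap_mk' K Γ
  have hΔ : Finite (Γ.comap (QuotientGroup.mk' K)) := by
    apply Nat.finite_of_card_ne_zero
    rw [hcard]
    exact mul_ne_zero Nat.card_pos.ne' Nat.card_pos.ne'
  obtain ⟨A, hAn, hAc, hAp, hAi⟩ := hG _ hΔ
  set f := (QuotientGroup.mk' K).subgroupComap Γ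
  have hf : Function.Surjective f :=
    MonoidHom.subgroupComap_surjective_of_surjective _ _ (QuotientGroup.mk'_surjective K)
  refine ⟨A.map f, hAn.map f hf, ?_, ?_, ?_⟩
  · rintro ⟨_, a, ha, rfl⟩ ⟨_, b, hb, rfl⟩
    have hab : a * b = b * a := congrArg Subtype.val (hAc ⟨a, ha⟩ ⟨b, hb⟩)
    exact Subtype.ext (by simp only [Subgroup.coe_mul, ← map_mul, hab])
  · exact fun h => hAp (h.trans (Subgroup.card_map_dvd A f))
  · intro P Q
    let S : Sylow p (Γ.comap (QuotientGroup.mk' K)) := default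
    have hS : Nat.card S.toSubgroup = Nat.card P.toSubgroup * Nat.card Q.toSubgroup := by
      rw [S.card_eq_multiplicity, P.card_eq_multiplicity, Q.card_eq_multiplicity, hcard,
        Nat.factorization_mul Nat.card_pos.ne' Nat.card_pos.ne', Finsupp.add_apply, pow_add,
        mul_comm]
    calc (A.map f).index ≤ A.index :=
          Nat.le_of_dvd (Nat.pos_of_ne_zero A.index_ne_zero_of_finite) (A.index_map_dvd hf)
      _ ≤ J' * Nat.card S.toSubgroup ^ e := hAi S
      _ = J' * Nat.card P.toSubgroup ^ e * Nat.card Q.toSubgroup ^ e := by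
          rw [hS, mul_pow, mul_assoc]
end

section
/- Let p be a prime, let H be a finite group, and let K be a normal subgroup of H such that the quotient H/K has order not divisible by p and K possesses a normal Sylow p-subgroup. Then H contains a subgroup H_C whose order is not divisible by p and whose image under the quotient map H → H/K is all of H/K. -/
/-- Let `p` be a prime, `H` a finite group, and `K ⊴ H` such that `p ∤ |H/K|`
and `K` possesses a normal Sylow `p`-subgroup. Then `H` contains a subgroup
`H_C` of order not divisible by `p` mapping onto `H/K`. -/
theorem stmt_10 (p : ℕ) (hp : p.Prime) (H : Type*) [Group H] [Finite H]
    (K : Subgroup H) [K.Normal] (hq : ¬ p ∣ Nat.card (H ⧸ K))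
    (hKp : ∃ P : Sylow p ↥K, P.toSubgroup.Normal) :
    ∃ HC : Subgroup H, ¬ p ∣ Nat.card HC ∧
      HC.map (QuotientGroup.mk' K) = ⊤ := by
  obtain ⟨P, hP⟩ := hKp
  have := Fact.mk hp
  have : P.toSubgroup.Characteristic := P.characteristic_of_normal hP
  set N : Subgroup H := P.toSubgroup.map K.subtype with hN
  have hNK : N ≤ K := Subgroup.map_subtype_le _
  have hN_normal : N.Normal := inferInstance
  have h_index : ¬ p ∣ N.index := by
    rw [← Subgroup.relIndex_mul_index hNK, hp.dvd_mul, not_or]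
    refine ⟨?_, hq⟩
    rw [Subgroup.relIndex, hN, Subgroup.subgroupOf,
      Subgroup.comap_map_eq_self_of_injective K.subtype_injective]
    exact P.not_dvd_index
  have h_coprime : (Nat.card N).Coprime N.index := by
    obtain ⟨n, hn⟩ := IsPGroup.iff_card.mp (P.isPGroup'.map K.subtype)
    rw [hN, hn]
    exact (hp.coprime_iff_not_dvd.mpr h_index).pow_left n
  obtain ⟨C, hC⟩ := Subgroup.exists_right_complement'_of_coprime h_coprime
  refine ⟨C, by rwa [← hC.symm.index_eq_card], ?_⟩
  have h_bot : N.map (QuotientGroup.mk' K) = ⊥ := by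
    rwa [Subgroup.map_eq_bot_iff, QuotientGroup.ker_mk']
  rw [← bot_sup_eq (C.map _), ← h_bot, ← Subgroup.map_sup, hC.sup_eq_top,
    Subgroup.map_top_of_surjective _ (QuotientGroup.mk'_surjective K)]
end

section
/- Let k be an algebraically closed field, let r be a nonnegative integer, let H be a group, and let N be a normal subgroup of H isomorphic to the direct product (kˣ)^r of r copies of the multiplicative group of k, such that the quotient Γ = H/N is finite of order n. Then there exists a finite subgroup F of H whose image under the quotient map H → Γ is all of Γ and such that S = F ∩ N is contained in the n-torsion subgroup N[n] = {x ∈ N : xⁿ = 1}; in particular, the order of S divides n^r. -/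
open scoped IsMulCommutative in
/-- For an abelian normal subgroup `N` of finite index, the `Nat.card (H ⧸ N)`-power map of `N`
extends to a crossed homomorphism `H → N` for the conjugation action. -/
theorem exists_crossedHom_extending_pow {H : Type*} [Group H] (N : Subgroup H) [N.Normal]
    [IsMulCommutative N] [Finite (H ⧸ N)] :
    ∃ φ : H → N, (∀ z : N, φ z = z ^ Nat.card (H ⧸ N)) ∧
      ∀ g h, φ (g * h) = MulAut.conjNormal g (φ h) * φ g := by
  have := Fintype.ofFinite (H ⧸ N)
  have mem (h : H) (b : H ⧸ N) : h * b.out * (h • b).out⁻¹ ∈ N := by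
    rw [← QuotientGroup.eq_one_iff, QuotientGroup.mk_mul, QuotientGroup.mk_inv,
      QuotientGroup.out_eq', mul_inv_eq_one]
    conv_rhs => rw [← QuotientGroup.out_eq' b]
    rfl
  refine ⟨fun h => ∏ b : H ⧸ N, ⟨_, mem h b⟩, fun z => ?_, fun g h => ?_⟩
  · rw [Nat.card_eq_fintype_card, ← Finset.card_univ, ← Finset.prod_const]
    refine Finset.prod_congr rfl fun b _ => Subtype.ext ?_
    have hz : (z : H) • b = b := by
      induction b using QuotientGroup.induction_on with
      | H b =>
        change ((z * b : H) : H ⧸ N) = b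
        rw [QuotientGroup.mk_mul, (QuotientGroup.eq_one_iff _).2 z.2, one_mul]
    simp [hz]
  · beta_reduce
    rw [map_prod, ← Equiv.prod_comp (MulAction.toPerm h) fun b : H ⧸ N => (⟨_, mem g b⟩ : N),
      ← Finset.prod_mul_distrib]
    refine Finset.prod_congr rfl fun b _ => Subtype.ext ?_
    simp [mul_smul, mul_assoc]

/-- A divisible abelian normal subgroup `N` of finite index `n` has a supplement meeting `N` exactly
in the `n`-torsion. -/
theorem exists_supplement_inf_eq_torsion {H : Type*} [Group H] (N : Subgroup H) [N.Normal]
    [IsMulCommutative N] [Finite (H ⧸ N)]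
    (hdiv : ∀ x : N, ∃ z : N, z ^ Nat.card (H ⧸ N) = x) :
    ∃ F : Subgroup H, F.map (QuotientGroup.mk' N) = ⊤ ∧
      ∀ x : N, (x : H) ∈ F ↔ x ^ Nat.card (H ⧸ N) = 1 := by
  obtain ⟨φ, hpow, hmul⟩ := exists_crossedHom_extending_pow N
  have hone : φ 1 = 1 := by simpa using hpow 1
  refine ⟨{ carrier := {h | φ h = 1}
            one_mem' := hone
            mul_mem' := fun {a b} ha hb => ?_
            inv_mem' := fun {a} ha => ?_ }, ?_, fun x => ?_⟩
  · simp only [Set.mem_ofPred_eq] at *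
    simp [hmul, ha, hb]
  · simp only [Set.mem_ofPred_eq] at *
    simpa [ha, hone] using (hmul a⁻¹ a).symm
  · refine eq_top_iff.2 fun q _ => ?_
    obtain ⟨h, rfl⟩ := QuotientGroup.mk'_surjective N q
    obtain ⟨z, hz⟩ := hdiv (φ h)⁻¹
    have hconj : MulAut.conjNormal (z : H) (φ h) = φ h := by
      refine Subtype.ext ?_
      rw [MulAut.conjNormal_apply, mul_inv_eq_iff_eq_mul]
      exact congrArg Subtype.val (mul_comm' z (φ h))
    refine ⟨z * h, ?_, ?_⟩
    · change φ (z * h) = 1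
      rw [hmul, hpow, hz, hconj, mul_inv_cancel]
    · rw [map_mul, QuotientGroup.mk'_apply, (QuotientGroup.eq_one_iff _).2 z.2, one_mul]
  · change φ x = 1 ↔ _
    rw [hpow]

theorem card_rootsOfUnity_dvd (R : Type*) [CommRing R] [IsDomain R] (n : ℕ) [NeZero n] :
    Nat.card (rootsOfUnity n R) ∣ n := by
  rw [← IsCyclic.exponent_eq_card]
  exact Monoid.exponent_dvd_of_forall_pow_eq_one fun x => Subtype.ext x.2

theorem exists_pow_eq_of_isAlgClosed {k : Type*} [Field k] [IsAlgClosed k] {n : ℕ} (hn : 0 < n)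
    (u : kˣ) : ∃ v : kˣ, v ^ n = u := by
  obtain ⟨z, hz⟩ := IsAlgClosed.exists_pow_nat_eq (u : k) hn
  have hz0 : z ≠ 0 := by
    rintro rfl
    exact u.ne_zero (by rw [← hz, zero_pow hn.ne'])
  exact ⟨Units.mk0 z hz0, Units.ext hz⟩


/-- Let `k` be an algebraically closed field, `H` a group, and `N ⊴ H` with
`N ≅ (kˣ)^r` and `Γ = H/N` finite of order `n`. Then there is a finite
subgroup `F` of `H` mapping onto `Γ` such that `S = F ⊓ N` is contained in the
`n`-torsion subgroup of `N`; in particular `|S|` divides `n^r`. -/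
theorem stmt_11 (k : Type*) [Field k] [IsAlgClosed k] (r : ℕ)
    (H : Type*) [Group H] (N : Subgroup H) [N.Normal]
    (e : ↥N ≃* (Fin r → kˣ)) [Finite (H ⧸ N)] :
    ∃ F : Subgroup H, Finite F ∧
      F.map (QuotientGroup.mk' N) = ⊤ ∧
      (∀ x ∈ F ⊓ N, x ^ Nat.card (H ⧸ N) = 1) ∧
      Nat.card ↥(F ⊓ N) ∣ Nat.card (H ⧸ N) ^ r := by
  have : IsMulCommutative N := ⟨⟨fun a b => e.injective (by rw [map_mul, map_mul, mul_comm])⟩⟩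
  have hn : 0 < Nat.card (H ⧸ N) := Nat.card_pos
  have : NeZero (Nat.card (H ⧸ N)) := ⟨hn.ne'⟩
  obtain ⟨F, hmap, hF⟩ := exists_supplement_inf_eq_torsion N fun x => by
    choose v hv using fun i => exists_pow_eq_of_isAlgClosed hn (e x i)
    exact ⟨e.symm v, e.injective (by rw [map_pow, e.apply_symm_apply]; exact funext hv)⟩
  have htors (x : ↥(F ⊓ N)) : (⟨x, x.2.2⟩ : N) ^ Nat.card (H ⧸ N) = 1 := (hF _).1 x.2.1
  let f : ↥(F ⊓ N) →* (Fin r → rootsOfUnity (Nat.card (H ⧸ N)) k) :=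
    { toFun x i := ⟨e ⟨x, x.2.2⟩ i, by
        rw [mem_rootsOfUnity, ← Pi.pow_apply, ← map_pow, htors, map_one, Pi.one_apply]⟩
      map_one' := funext fun i => Subtype.ext (congrFun (map_one e) i)
      map_mul' x y := funext fun i =>
        Subtype.ext (congrFun (map_mul e ⟨x, x.2.2⟩ ⟨y, y.2.2⟩) i) }
  have hf : Function.Injective f := fun x y hxy => by
    have h : e ⟨x, x.2.2⟩ = e ⟨y, y.2.2⟩ := funext fun i => congrArg Subtype.val (congrFun hxy i)
    exact Subtype.ext (by simpa using e.injective h)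
  have : Finite ↥(F ⊓ N) := Finite.of_injective f hf
  refine ⟨F, ?_, hmap, fun x hx => congrArg Subtype.val (htors ⟨x, hx⟩), ?_⟩
  · let q : F →* H ⧸ N := (QuotientGroup.mk' N).comp F.subtype
    have : Finite q.ker := Finite.of_injective
      (fun x : q.ker => (⟨x, x.1.2, (QuotientGroup.eq_one_iff _).1 x.2⟩ : ↥(F ⊓ N)))
      fun x y h => Subtype.ext (Subtype.ext (Subtype.mk.inj h))
    have : Finite (F ⧸ q.ker) := Finite.of_injective _ (QuotientGroup.kerLift_injective q)
    exact Finite.of_subgroup_quotient q.ker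
  · refine (Subgroup.card_dvd_of_injective f hf).trans ?_
    rw [Nat.card_fun, Nat.card_fin]
    exact pow_dvd_pow_of_dvd (card_rootsOfUnity_dvd k _) r
end

section
/- Let Γ be a finite group and let A be an abelian subgroup of Γ. Then Γ contains a characteristic abelian subgroup M (a subgroup invariant under every automorphism of Γ, hence normal in Γ) with [Γ : M] ≤ [Γ : A]². -/
namespace Subgroup

variable {G : Type*} [Group G]

/-- The Chermak–Delgado measure of a subgroup. -/
noncomputable def chermakDelgado (H : Subgroup G) : ℕ :=
  Nat.card H * Nat.card (centralizer (H : Set G))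

variable [Finite G]

theorem card_mul_card_le_card_inf_mul_card_sup (H K : Subgroup G) :
    Nat.card H * Nat.card K ≤ Nat.card ↥(H ⊓ K) * Nat.card ↥(H ⊔ K) := by
  have h_inf : Nat.card ↥(H ⊓ K) * K.relIndex H = Nat.card H := by
    rw [← inf_relIndex_left, ← relIndex_bot_left, ← relIndex_bot_left,
      relIndex_mul_relIndex _ _ _ bot_le inf_le_left]
  have h_sup : Nat.card K * K.relIndex (H ⊔ K) = Nat.card ↥(H ⊔ K) := by
    rw [← relIndex_bot_left, ← relIndex_bot_left,
      relIndex_mul_relIndex _ _ _ bot_le le_sup_right]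
  have h_le : K.relIndex H ≤ K.relIndex (H ⊔ K) :=
    relIndex_le_of_le_right le_sup_left index_ne_zero_of_finite
  rw [← h_inf, ← h_sup, mul_assoc, mul_comm (K.relIndex H)]
  gcongr

theorem chermakDelgado_mul_le (H K : Subgroup G) :
    H.chermakDelgado * K.chermakDelgado ≤
      (H ⊓ K).chermakDelgado * (H ⊔ K).chermakDelgado := by
  have h_inf : centralizer (H : Set G) ⊓ centralizer (K : Set G) ≤
      centralizer ((H ⊔ K : Subgroup G) : Set G) := by
    rw [le_centralizer_iff, sup_le_iff, le_centralizer_iff, le_centralizer_iff (H := K)]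
    exact ⟨inf_le_left, inf_le_right⟩
  have h_sup : centralizer (H : Set G) ⊔ centralizer (K : Set G) ≤
      centralizer ((H ⊓ K : Subgroup G) : Set G) :=
    sup_le (centralizer_le fun _ hx => hx.1) (centralizer_le fun _ hx => hx.2)
  unfold chermakDelgado
  calc _ = (Nat.card H * Nat.card K) *
        (Nat.card (centralizer (H : Set G)) * Nat.card (centralizer (K : Set G))) := by ring
    _ ≤ (Nat.card ↥(H ⊓ K) * Nat.card ↥(H ⊔ K)) *
        (Nat.card (centralizer ((H ⊔ K : Subgroup G) : Set G)) *
          Nat.card (centralizer ((H ⊓ K : Subgroup G) : Set G))) := by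
      gcongr ?_ * ?_
      · exact card_mul_card_le_card_inf_mul_card_sup H K
      · exact (card_mul_card_le_card_inf_mul_card_sup _ _).trans
          (Nat.mul_le_mul (card_le_of_le h_inf) (card_le_of_le h_sup))
    _ = _ := by ring

theorem chermakDelgado_pos (H : Subgroup G) : 0 < H.chermakDelgado :=
  Nat.mul_pos Nat.card_pos Nat.card_pos

theorem chermakDelgado_le_centralizer (H : Subgroup G) :
    H.chermakDelgado ≤ (centralizer (H : Set G)).chermakDelgado := by
  unfold chermakDelgado
  rw [mul_comm]
  exact Nat.mul_le_mul_left _ (card_le_of_le (le_centralizer_iff.mp le_rfl))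

theorem chermakDelgado_le_map (H : Subgroup G) (f : G ≃* G) :
    H.chermakDelgado ≤ (H.map f.toMonoidHom).chermakDelgado := by
  unfold chermakDelgado
  have hf : Function.Injective f.toMonoidHom := f.injective
  rw [card_map_of_injective hf, ← card_map_of_injective (K := centralizer (H : Set G)) hf]
  exact Nat.mul_le_mul_left _ (card_le_of_le (map_centralizer_le_centralizer_image _ _))

/-- Some subgroup of maximal Chermak–Delgado measure is contained in all the others. -/
theorem exists_least_chermakDelgado_maximal (G : Type*) [Group G] [Finite G] :
    ∃ M : Subgroup G, (∀ K : Subgroup G, K.chermakDelgado ≤ M.chermakDelgado) ∧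
      ∀ K : Subgroup G, M.chermakDelgado ≤ K.chermakDelgado → M ≤ K := by
  obtain ⟨N, hN⟩ := Finite.exists_max (chermakDelgado : Subgroup G → ℕ)
  obtain ⟨M, hM⟩ :=
    (Set.toFinite {H : Subgroup G | N.chermakDelgado ≤ H.chermakDelgado}).exists_minimal
      ⟨N, le_refl N.chermakDelgado⟩
  have h_max (K : Subgroup G) : K.chermakDelgado ≤ M.chermakDelgado := (hN K).trans hM.prop
  refine ⟨M, h_max, fun K hK => ?_⟩
  have h_inf : M.chermakDelgado ≤ (M ⊓ K).chermakDelgado :=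
    Nat.le_of_mul_le_mul_right
      ((Nat.mul_le_mul_left _ hK).trans <| (chermakDelgado_mul_le M K).trans
        (Nat.mul_le_mul_left _ (h_max _)))
      M.chermakDelgado_pos
  exact (hM.le_of_le (le_trans hM.prop h_inf) inf_le_left).trans inf_le_right

end Subgroup

/-- Chermak–Delgado: a finite group `Γ` with an abelian subgroup `A` contains a
characteristic abelian subgroup `M` with `[Γ : M] ≤ [Γ : A]²`. -/
theorem stmt_12 (Γ : Type*) [Group Γ] [Finite Γ] (A : Subgroup Γ)
    (hA : ∀ x ∈ A, ∀ y ∈ A, x * y = y * x) :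
    ∃ M : Subgroup Γ, M.Characteristic ∧ (∀ x ∈ M, ∀ y ∈ M, x * y = y * x) ∧
      M.index ≤ A.index ^ 2 := by
  obtain ⟨M, h_max, h_least⟩ := Subgroup.exists_least_chermakDelgado_maximal Γ
  refine ⟨M, Subgroup.characteristic_iff_le_map.mpr fun f =>
    h_least _ (M.chermakDelgado_le_map f), fun x hx y hy => ?_, ?_⟩
  · exact Subgroup.mem_centralizer_iff.mp
      (h_least _ M.chermakDelgado_le_centralizer hy) x hx
  · have hA_le : A ≤ Subgroup.centralizer (A : Set Γ) := fun x hx =>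
      Subgroup.mem_centralizer_iff.mpr fun y hy => hA y hy x hx
    have h_card : Nat.card A ^ 2 ≤ Nat.card M * Nat.card Γ := by
      rw [sq]
      exact (Nat.mul_le_mul_left _ (Subgroup.card_le_of_le hA_le)).trans
        ((h_max A).trans (Nat.mul_le_mul_left _ (Subgroup.card_le_card_group _)))
    have h_pos : 0 < Nat.card M * Nat.card Γ := Nat.mul_pos Nat.card_pos Nat.card_pos
    refine Nat.le_of_mul_le_mul_left ?_ h_pos
    calc Nat.card M * Nat.card Γ * M.index = (Nat.card M * M.index) * Nat.card Γ := by ring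
      _ = (Nat.card A * A.index) ^ 2 := by
        rw [M.card_mul_index, A.card_mul_index, sq]
      _ = Nat.card A ^ 2 * A.index ^ 2 := mul_pow _ _ _
      _ ≤ Nat.card M * Nat.card Γ * A.index ^ 2 := Nat.mul_le_mul_right _ h_card
end
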